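/- Assume ω is alternating, and let e be a nilpotent endomorphism of V that is skew-adjoint with respect to ω. Then for every odd integer s ≥ 1, the integer rank(e^{s−1}) + rank(e^{s+1}) is even. Equivalently, for every odd s ≥ 1 the number of Jordan blocks of e of size s, which equals rank(e^{s−1}) − 2·rank(e^s) + rank(e^{s+1}), is even. -/

import Mathlib

open Module Submodule

theorem even_of_nondeg (W : Type*) [AddCommGroup W] [Module ℂ W] [FiniteDimensional ℂ W]
    (B : W →ₗ[ℂ] W →ₗ[ℂ] ℂ) (hnd : ∀ v, (∀ w, B v w = 0) → v = 0)
    (halt : ∀ v, B v v = 0) : Even (finrank ℂ W) := by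
  by_contra hodd
  rw [Nat.not_even_iff_odd] at hodd
  let b := Module.finBasis ℂ W
  let M : Matrix (Fin (finrank ℂ W)) (Fin (finrank ℂ W)) ℂ := LinearMap.toMatrix₂ b b B
  have hneg : ∀ x y, -B x y = B y x := LinearMap.IsAlt.neg halt
  have hT : M.transpose = -M := by
    ext i j
    simp [M, LinearMap.toMatrix₂_apply, hneg]
  have hdet : M.det = 0 := by
    have h := congrArg Matrix.det hT
    rw [Matrix.det_transpose, Matrix.det_neg, Fintype.card_fin, hodd.neg_one_pow] at h
    have : 2 * M.det = 0 := by linear_combination h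
    simpa using this
  obtain ⟨v, hv, hv0⟩ := Matrix.exists_vecMul_eq_zero_iff.mpr hdet
  apply hv
  have hx : b.equivFun.symm v = 0 := by
    apply hnd
    have : B (b.equivFun.symm v) = 0 := by
      apply b.ext
      intro j
      have := congrFun hv0 j
      simpa [M, Matrix.vecMul, dotProduct, LinearMap.toMatrix₂_apply, Basis.equivFun_symm_apply] using this
    intro w
    rw [this, LinearMap.zero_apply]
  exact (LinearEquiv.map_eq_zero_iff _).mp hx

theorem even_rank_alt (V : Type*) [AddCommGroup V] [Module ℂ V] [FiniteDimensional ℂ V]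
    (B : V →ₗ[ℂ] V →ₗ[ℂ] ℂ) (halt : ∀ v, B v v = 0) :
    Even (finrank ℂ (LinearMap.range B)) := by
  have hneg : ∀ x y, -B x y = B y x := LinearMap.IsAlt.neg halt
  obtain ⟨W, hW⟩ := (LinearMap.ker B).exists_isCompl
  have h1 := Submodule.finrank_add_eq_of_isCompl hW
  have h2 := LinearMap.finrank_range_add_finrank_ker B
  have h3 : finrank ℂ (LinearMap.range B) = finrank ℂ W := by omega
  rw [h3]
  apply even_of_nondeg W (B.domRestrict₁₂ W W)
  · intro w hw
    have hk : (w : V) ∈ LinearMap.ker B := by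
      rw [LinearMap.mem_ker]
      ext y
      obtain ⟨k, hk, z, hz, rfl⟩ := Submodule.mem_sup.mp
        (show y ∈ LinearMap.ker B ⊔ W by rw [hW.sup_eq_top]; trivial)
      have e1 : B w z = 0 := hw ⟨z, hz⟩
      have e2 : B w k = 0 := by
        rw [← hneg, LinearMap.mem_ker.mp hk]; simp
      simp [e1, e2]
    have := Submodule.disjoint_def.mp hW.disjoint w hk w.2
    exact Subtype.ext this
  · intro w
    exact halt w

/-- Parity constraint on Jordan types of nilpotent elements of a
symplectic Lie algebra: if `ω` is nondegenerate alternating and `e` is a nilpotent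
endomorphism skew-adjoint with respect to `ω`, then for every odd `s ≥ 1` the integer
`rank(e^{s−1}) + rank(e^{s+1})` is even. -/
theorem stmt_16 (V : Type*) [AddCommGroup V] [Module ℂ V] [FiniteDimensional ℂ V]
    (ω : V →ₗ[ℂ] V →ₗ[ℂ] ℂ)
    (hnd : ∀ v, (∀ w, ω v w = 0) → v = 0)
    (halt : ∀ v, ω v v = 0)
    (e : Module.End ℂ V) (hnil : IsNilpotent e)
    (hskew : ∀ v w, ω (e v) w = - ω v (e w)) :
    ∀ s : ℕ, 1 ≤ s → Odd s →
      Even (finrank ℂ (LinearMap.range (e ^ (s - 1))) +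
        finrank ℂ (LinearMap.range (e ^ (s + 1)))) := by
  have hpow : ∀ (m : ℕ) (v w : V), ω ((e ^ m) v) w = (-1) ^ m * ω v ((e ^ m) w) := by
    intro m
    induction m with
    | zero => simp
    | succ m ih =>
      intro v w
      rw [pow_succ, Module.End.mul_apply, ih, hskew, ← Module.End.mul_apply, ← pow_succ',
        ← pow_succ]
      ring
  have hinj : Function.Injective ω := by
    rw [← LinearMap.ker_eq_bot, LinearMap.ker_eq_bot']
    intro v hv
    exact hnd v (by simp [hv])
  have key : ∀ m : ℕ, Even (finrank ℂ (LinearMap.range (e ^ (m + m)))) := by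
    intro m
    have h := even_rank_alt V (ω ∘ₗ (e ^ (m + m))) (by
      intro v
      rw [LinearMap.comp_apply, pow_add, Module.End.mul_apply, hpow, halt, mul_zero])
    rw [LinearMap.range_comp,
      ← (Submodule.equivMapOfInjective ω hinj (LinearMap.range (e ^ (m + m)))).finrank_eq] at h
    exact h
  rintro s - ⟨m, rfl⟩
  have a1 : 2 * m + 1 - 1 = m + m := by omega
  have a2 : 2 * m + 1 + 1 = (m + 1) + (m + 1) := by omega
  rw [a1, a2]
  exact (key m).add (key (m + 1))
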